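/- Let n ≥ 2, h ≤ σ, and q ∈ [1,∞]. There exists a constant C > 0 depending only on a, n, q, D and T such that for every t ∈ [0,T] and every v_σ ∈ V_σ^n(Ω): ( Σ_{i=1}^N w_i ‖v_σ‖_{L^∞(X_{0→t}(Q_i^h))}^q )^{1/q} ≤ C ‖v_σ‖_{L^q(Ω)} (with the usual modification max_i ‖v_σ‖_{L^∞(X_{0→t}(Q_i^h))} ≤ C‖v_σ‖_{L^∞(Ω)} for q = ∞). -/

import Mathlib

open MeasureTheory
open scoped ENNReal NNReal

noncomputable section

/-- The open unit cube `Ω = (0,1)^D`. -/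
def unitCube (D : ℕ) : Set (Fin D → ℝ) := {x | ∀ i, x i ∈ Set.Ioo (0 : ℝ) 1}

/-- The grid cell with multi-index `k` in the uniform partition of the unit cube into
`M^D` cubes of edge length `1/M`. -/
def cell (D M : ℕ) (k : Fin D → Fin M) : Set (Fin D → ℝ) :=
  {x | ∀ i, ((k i : ℕ) : ℝ) / M ≤ x i ∧ x i < (((k i : ℕ) : ℝ) + 1) / M}

/-- Membership in the tensor-product spline space `V_σ^n(Ω)`, `σ = 1/M`: the function is
`C^{n-2}` on `Ω` and coincides on every grid cell with a polynomial of coordinate-wise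
degree at most `n-1`. -/
def IsSpline (D M n : ℕ) (u : (Fin D → ℝ) → ℝ) : Prop :=
  ContDiffOn ℝ (n - 2 : ℕ) u (unitCube D) ∧
  ∀ k : Fin D → Fin M, ∃ p : MvPolynomial (Fin D) ℝ,
    (∀ i, p.degreeOf i ≤ n - 1) ∧ ∀ x ∈ cell D M k, u x = MvPolynomial.eval x p

/-- A smooth, bounded, divergence-free velocity field `a` on `Ω × [0,T]`, tangent to the
boundary of the unit cube, together with its flow maps: `X τ t = X_{τ→t}`, so that
`X τ t x` is the position at time `t` of the trajectory passing through `x` at time `τ`. -/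
structure FlowData (D : ℕ) (T : ℝ) where
  a : (Fin D → ℝ) → ℝ → (Fin D → ℝ)
  X : ℝ → ℝ → (Fin D → ℝ) → (Fin D → ℝ)
  smooth : ContDiff ℝ (⊤ : ℕ∞) (Function.uncurry a)
  bounded : ∃ B, ∀ x t, ‖a x t‖ ≤ B
  div_free : ∀ x t, ∑ i, fderiv ℝ (fun y => a y t i) x (Pi.single i 1) = 0
  tangent : ∀ t ∈ Set.Icc (0 : ℝ) T, ∀ x ∈ closure (unitCube D), ∀ i,
      (x i = 0 ∨ x i = 1) → a x t i = 0
  flow_init : ∀ τ x, X τ τ x = x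
  flow_ode : ∀ τ x t, HasDerivAt (fun s => X τ s x) (a (X τ t x) t) t
  flow_inv : ∀ τ t x, X t τ (X τ t x) = x

def boxE (s : ℝ) : ℝ := s - max 0 (min 1 s)

lemma boxE_sq_deriv (x : ℝ) : HasDerivAt (fun s => boxE s ^ 2) (2 * boxE x) x := by
  rw [hasDerivAt_iff_isLittleO]
  refine Asymptotics.IsBigO.trans_isLittleO (g := fun y => (y - x) ^ 2) ?_ ?_
  · refine Asymptotics.IsBigO.of_bound 1 (Filter.Eventually.of_forall fun y => ?_)
    simp only [smul_eq_mul, Real.norm_eq_abs, one_mul]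
    rw [abs_of_nonneg (sq_nonneg (y - x)), abs_le]
    unfold boxE
    rcases le_total 1 x with hx | hx <;> rcases le_total 1 y with hy | hy
    · rw [min_eq_left hx, min_eq_left hy, max_eq_right zero_le_one]
      constructor <;> nlinarith
    · rw [min_eq_left hx, min_eq_right hy, max_eq_right zero_le_one]
      rcases le_total 0 y with h | h
      · rw [max_eq_right h]; constructor <;> nlinarith
      · rw [max_eq_left h]; constructor <;> nlinarith
    · rw [min_eq_left hy, min_eq_right hx, max_eq_right zero_le_one]
      rcases le_total 0 x with h | h
      · rw [max_eq_right h]; constructor <;> nlinarith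
      · rw [max_eq_left h]; constructor <;> nlinarith
    · rw [min_eq_right hy, min_eq_right hx]
      rcases le_total 0 x with h | h <;> rcases le_total 0 y with h' | h'
      · rw [max_eq_right h, max_eq_right h']; constructor <;> nlinarith
      · rw [max_eq_right h, max_eq_left h']; constructor <;> nlinarith
      · rw [max_eq_left h, max_eq_right h']; constructor <;> nlinarith
      · rw [max_eq_left h, max_eq_left h']; constructor <;> nlinarith
  · have := (Asymptotics.isLittleO_pow_id (𝕜 := ℝ) (n := 2) (by norm_num))
    refine this.comp_tendsto (k := fun y => y - x) ?_
    have : Filter.Tendsto (fun y => y - x) (nhds x) (nhds (x - x)) :=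
      (continuous_id.sub continuous_const).tendsto x
    simpa using this

lemma Icc_subset_closure (D : ℕ) : Set.Icc (0 : Fin D → ℝ) 1 ⊆ closure (unitCube D) := by
  have : unitCube D = Set.pi Set.univ (fun _ => Set.Ioo (0:ℝ) 1) := by
    ext x; simp [unitCube]
  rw [this, closure_pi_set]
  intro x hx i _
  rw [closure_Ioo (by norm_num)]
  exact ⟨hx.1 i, hx.2 i⟩

lemma flow_bdd {D : ℕ} {T : ℝ} (F : FlowData D T) :
    ∃ R : ℝ, 1 ≤ R ∧ ∀ x ∈ Set.Icc (0 : Fin D → ℝ) 1, ∀ t ∈ Set.Icc (0:ℝ) T,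
      F.X 0 t x ∈ Metric.closedBall (0 : Fin D → ℝ) R := by
  obtain ⟨B, hB⟩ := F.bounded
  have hB0 : 0 ≤ B := (norm_nonneg _).trans (hB 0 0)
  refine ⟨1 + B * |T|, by nlinarith [abs_nonneg T], fun x hx t ht => ?_⟩
  have h1 := norm_image_sub_le_of_norm_deriv_le_segment' (f := fun s => F.X 0 s x) (a := 0) (b := T)
    (fun s _ => (F.flow_ode 0 x s).hasDerivWithinAt) (fun s _ => hB _ _) t ht
  simp only [F.flow_init] at h1
  have h2 : ‖x‖ ≤ 1 := by
    rw [pi_norm_le_iff_of_nonneg zero_le_one]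
    intro i
    have a := hx.1 i
    have b := hx.2 i
    simp at a b
    rw [Real.norm_eq_abs, abs_le]; constructor <;> linarith
  rw [mem_closedBall_zero_iff]
  calc ‖F.X 0 t x‖ = ‖(F.X 0 t x - x) + x‖ := by simp
    _ ≤ ‖F.X 0 t x - x‖ + ‖x‖ := norm_add_le _ _
    _ ≤ B * (t - 0) + 1 := add_le_add h1 h2
    _ ≤ 1 + B * |T| := by
      have : t ≤ |T| := ht.2.trans (le_abs_self T)
      nlinarith

lemma flow_lip {D : ℕ} {T : ℝ} (F : FlowData D T) (R : ℝ) :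
    ∃ L : ℝ≥0, ∀ t ∈ Set.Icc (0:ℝ) T,
      LipschitzOnWith L (fun x => F.a x t) (Metric.closedBall (0 : Fin D → ℝ) R) := by
  obtain ⟨L, hL⟩ := ContDiffOn.exists_lipschitzOnWith
    (s := (Metric.closedBall (0 : Fin D → ℝ) R) ×ˢ Set.Icc (0:ℝ) T)
    (F.smooth.contDiffOn) (by simp) ((convex_closedBall _ _).prod (convex_Icc _ _))
    ((isCompact_closedBall _ _).prod isCompact_Icc)
  refine ⟨L, fun t ht x hx y hy => ?_⟩
  have := hL (x := (x, t)) ⟨hx, ht⟩ (y := (y, t)) ⟨hy, ht⟩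
  simpa [Function.uncurry, Prod.edist_eq] using this

lemma flow_invariant {D : ℕ} {T : ℝ} (F : FlowData D T) :
    ∀ x ∈ Set.Icc (0 : Fin D → ℝ) 1, ∀ t ∈ Set.Icc (0:ℝ) T,
      F.X 0 t x ∈ Set.Icc (0 : Fin D → ℝ) 1 := by
  obtain ⟨R, hR1, hR⟩ := flow_bdd F
  obtain ⟨L, hL⟩ := flow_lip F R
  intro x hx
  have key : ∀ t ∈ Set.Icc (0:ℝ) T, (∑ i, boxE (F.X 0 t x i) ^ 2) = 0 := by
    have hd : ∀ t, HasDerivAt (fun s => ∑ i, boxE (F.X 0 s x i) ^ 2)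
        (∑ i, 2 * boxE (F.X 0 t x i) * F.a (F.X 0 t x) t i) t := by
      intro t
      refine HasDerivAt.fun_sum fun i _ => ?_
      have h1 := hasDerivAt_pi.1 (F.flow_ode 0 x t) i
      exact (boxE_sq_deriv _).comp t h1
    refine eq_zero_of_abs_deriv_le_mul_abs_self_of_eq_zero_right (K := 2 * D * L)
      (fun t _ => (hd t).continuousAt.continuousWithinAt) (fun t _ => (hd t).hasDerivWithinAt) ?_ ?_
    · rw [F.flow_init]
      refine Finset.sum_eq_zero fun i _ => ?_
      have a := hx.1 i
      have b := hx.2 i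
      simp at a b
      simp [boxE, a, b]
    · intro t ht
      have ht' : t ∈ Set.Icc (0:ℝ) T := ⟨ht.1, ht.2.le⟩
      set y := F.X 0 t x with hy
      have hyR := hR x hx t ht'
      rw [← hy] at hyR
      let p : Fin D → ℝ := fun i => max 0 (min 1 (y i))
      have hp01 : p ∈ Set.Icc (0 : Fin D → ℝ) 1 :=
        ⟨fun i => le_max_left _ _, fun i => max_le zero_le_one (min_le_left _ _)⟩
      have hpR : p ∈ Metric.closedBall (0 : Fin D → ℝ) R := by
        rw [mem_closedBall_zero_iff, pi_norm_le_iff_of_nonneg (by linarith)]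
        intro i
        have a := hp01.1 i
        have b := hp01.2 i
        simp only [Pi.zero_apply, Pi.one_apply] at a b
        rw [Real.norm_eq_abs, abs_le]; constructor <;> linarith
      have hlip := (hL t ht').dist_le_mul y hyR p hpR
      set S := ∑ i, boxE (y i) ^ 2 with hS
      have hS0 : 0 ≤ S := Finset.sum_nonneg fun i _ => sq_nonneg _
      have hei : ∀ i, |boxE (y i)| ≤ √S := by
        intro i
        apply Real.abs_le_sqrt
        exact Finset.single_le_sum (f := fun i => boxE (y i) ^ 2) (fun j _ => sq_nonneg _)
          (Finset.mem_univ i)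
      have hdist : dist y p ≤ √S := by
        rw [dist_pi_le_iff (Real.sqrt_nonneg _)]
        intro i
        exact hei i
      have hterm : ∀ i, |2 * boxE (y i) * F.a y t i| ≤ 2 * L * S := by
        intro i
        by_cases h0 : boxE (y i) = 0
        · rw [h0]; simp; positivity
        have hpi : p i = 0 ∨ p i = 1 := by
          by_contra hcon
          push Not at hcon
          apply h0
          simp only [p] at hcon
          unfold boxE
          rcases le_total 1 (y i) with h | h
          · simp [h] at hcon
          · rcases le_total 0 (y i) with h' | h'
            · simp [h, h']
            · simp [h, h'] at hcon
        have ha := F.tangent t ht' p (Icc_subset_closure D hp01) i hpi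
        have h1 : |F.a y t i| ≤ L * √S := by
          have : |F.a y t i| = dist (F.a y t i) (F.a p t i) := by
            rw [ha, Real.dist_eq, sub_zero]
          rw [this]
          refine (dist_le_pi_dist _ _ i).trans (hlip.trans ?_)
          gcongr
        rw [abs_mul, abs_mul, abs_two]
        calc 2 * |boxE (y i)| * |F.a y t i| ≤ 2 * √S * (L * √S) := by
              gcongr
              exact hei i
          _ = 2 * L * (√S * √S) := by ring
          _ = _ := by rw [Real.mul_self_sqrt hS0]
      rw [Real.norm_eq_abs, Real.norm_eq_abs, abs_of_nonneg hS0]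
      refine (Finset.abs_sum_le_sum_abs _ _).trans ((Finset.sum_le_sum fun i _ => hterm i).trans ?_)
      simp
      apply le_of_eq; ring
  intro t ht
  have h := key t ht
  rw [Finset.sum_eq_zero_iff_of_nonneg (fun i _ => sq_nonneg _)] at h
  have h' : ∀ i, F.X 0 t x i = max 0 (min 1 (F.X 0 t x i)) := by
    intro i
    have := h i (Finset.mem_univ i)
    rw [sq_eq_zero_iff] at this
    exact sub_eq_zero.1 this
  refine ⟨fun i => ?_, fun i => ?_⟩
  · rw [h' i]; exact le_max_left _ _
  · rw [h' i]; exact max_le zero_le_one (min_le_left _ _)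

lemma flow_back_lip {D : ℕ} {T : ℝ} (F : FlowData D T) :
    ∃ G : ℝ, 0 < G ∧ ∀ x ∈ Set.Icc (0 : Fin D → ℝ) 1, ∀ y ∈ Set.Icc (0 : Fin D → ℝ) 1,
      ∀ t ∈ Set.Icc (0:ℝ) T, dist x y ≤ G * dist (F.X 0 t x) (F.X 0 t y) := by
  obtain ⟨R, hR1, hR⟩ := flow_bdd F
  obtain ⟨L, hL⟩ := flow_lip F R
  refine ⟨Real.exp (L * T), Real.exp_pos _, fun x hx y hy t ht => ?_⟩
  have hd : ∀ x s, HasDerivAt (fun s => F.X 0 (t - s) x) (-F.a (F.X 0 (t - s) x) (t - s)) s := by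
    intro x s
    have h1 : HasDerivAt (fun s : ℝ => t - s) (-1) s := by
      simpa using (hasDerivAt_id s).const_sub t
    have := (F.flow_ode 0 x (t - s)).scomp s h1
    simpa [Function.comp_def] using this
  have h := dist_le_of_trajectories_ODE_of_mem (a := 0) (b := t) (K := L)
    (v := fun s x => -F.a x (t - s)) (s := fun _ => Metric.closedBall (0 : Fin D → ℝ) R)
    (f := fun s => F.X 0 (t - s) x) (g := fun s => F.X 0 (t - s) y)
    (δ := dist (F.X 0 (t - 0) x) (F.X 0 (t - 0) y))
    (fun s hs => (hL (t - s) ⟨by linarith [hs.2], by linarith [hs.1, ht.2]⟩).neg)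
    (fun s _ => (hd x s).continuousAt.continuousWithinAt)
    (fun s _ => (hd x s).hasDerivWithinAt)
    (fun s hs => hR x hx _ ⟨by linarith [hs.2], by linarith [hs.1, ht.2]⟩)
    (fun s _ => (hd y s).continuousAt.continuousWithinAt)
    (fun s _ => (hd y s).hasDerivWithinAt)
    (fun s hs => hR y hy _ ⟨by linarith [hs.2], by linarith [hs.1, ht.2]⟩)
    le_rfl t ⟨ht.1, le_rfl⟩
  simp only [sub_self, F.flow_init, sub_zero] at h
  refine h.trans ?_
  rw [mul_comm]
  gcongr
  exact ht.2

def hcube (D : ℕ) : Set (Fin D → ℝ) := Set.pi Set.univ (fun _ => Set.Ico (0:ℝ) 1)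

lemma hcube_meas (D : ℕ) : MeasurableSet (hcube D) :=
  MeasurableSet.univ_pi fun _ => measurableSet_Ico

lemma hcube_vol (D : ℕ) : volume (hcube D) = 1 := by
  rw [hcube, volume_pi_pi]; simp

instance hcube_prob (D : ℕ) : IsProbabilityMeasure (volume.restrict (hcube D)) :=
  ⟨by rw [Measure.restrict_apply_univ, hcube_vol]⟩

lemma unitCube_eq (D : ℕ) : unitCube D = Set.pi Set.univ (fun _ => Set.Ioo (0:ℝ) 1) := by
  ext x; simp [unitCube]

lemma unitCube_sub (D : ℕ) : unitCube D ⊆ hcube D := by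
  rw [unitCube_eq]
  exact Set.pi_mono fun _ _ => Set.Ioo_subset_Ico_self

def mono (D n : ℕ) (α : Fin D → Fin n) : Fin D →₀ ℕ :=
  Finsupp.equivFunOnFinite.symm (fun i => (α i : ℕ))

def Phi (D n : ℕ) : ((Fin D → Fin n) → ℝ) →ₗ[ℝ] MvPolynomial (Fin D) ℝ :=
  ∑ α, (MvPolynomial.monomial (mono D n α)) ∘ₗ LinearMap.proj α

lemma Phi_apply (D n : ℕ) (c : (Fin D → Fin n) → ℝ) :
    Phi D n c = ∑ α, MvPolynomial.monomial (mono D n α) (c α) := by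
  simp [Phi, LinearMap.sum_apply]

lemma mono_inj (D n : ℕ) : Function.Injective (mono D n) := by
  intro α β h
  have h := Finsupp.equivFunOnFinite.symm.injective h
  funext i
  exact Fin.ext (congrFun h i)

lemma Phi_coeff (D n : ℕ) (c : (Fin D → Fin n) → ℝ) (α : Fin D → Fin n) :
    (Phi D n c).coeff (mono D n α) = c α := by
  rw [Phi_apply, MvPolynomial.coeff_sum, Finset.sum_eq_single α]
  · simp
  · intro β _ hβ
    rw [MvPolynomial.coeff_monomial, if_neg]
    exact fun h => hβ (mono_inj D n h)
  · simp

lemma Phi_surj (D n : ℕ) (hn : 2 ≤ n) (p : MvPolynomial (Fin D) ℝ)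
    (hp : ∀ i, p.degreeOf i ≤ n - 1) : ∃ c, Phi D n c = p := by
  refine ⟨fun α => p.coeff (mono D n α), ?_⟩
  ext m
  by_cases hm : ∀ i, m i < n
  · have : m = mono D n (fun i => ⟨m i, hm i⟩) := by
      ext i; simp [mono]
    rw [this, Phi_coeff]
  · have h1 : p.coeff m = 0 := by
      by_contra h
      apply hm
      intro i
      have := MvPolynomial.degreeOf_le_iff.1 (hp i) m (MvPolynomial.mem_support_iff.2 h)
      omega
    rw [h1, Phi_apply, MvPolynomial.coeff_sum]
    refine Finset.sum_eq_zero fun α _ => ?_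
    rw [MvPolynomial.coeff_monomial, if_neg]
    rintro rfl
    exact hm fun i => (α i).2

lemma poly_cont {D : ℕ} (p : MvPolynomial (Fin D) ℝ) :
    Continuous (fun z : Fin D → ℝ => MvPolynomial.eval z p) := MvPolynomial.continuous_eval p

lemma Phi_bound (D n : ℕ) (c : (Fin D → Fin n) → ℝ) (y : Fin D → ℝ) (hy : y ∈ hcube D) :
    ‖MvPolynomial.eval y (Phi D n c)‖ ≤ (Fintype.card (Fin D → Fin n)) * ‖c‖ := by
  rw [Phi_apply, map_sum]
  refine (norm_sum_le _ _).trans ((Finset.sum_le_sum (g := fun _ => ‖c‖) fun α _ => ?_).trans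
    (by simp))
  rw [MvPolynomial.eval_monomial, norm_mul]
  have h1 : ‖(mono D n α).prod fun i e => y i ^ e‖ ≤ 1 := by
    rw [Finsupp.prod, norm_prod]
    refine Finset.prod_le_one (fun i _ => norm_nonneg _) fun i _ => ?_
    have := hy i (Set.mem_univ i)
    rw [norm_pow, Real.norm_eq_abs, abs_of_nonneg this.1]
    exact pow_le_one₀ this.1 this.2.le
  calc ‖c α‖ * _ ≤ ‖c‖ * 1 := by
        gcongr
        exact norm_le_pi_norm c α
    _ = ‖c‖ := mul_one _

lemma Phi_memLp (D n : ℕ) (c : (Fin D → Fin n) → ℝ) :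
    MemLp (fun z => MvPolynomial.eval z (Phi D n c)) 1 (volume.restrict (hcube D)) := by
  refine MemLp.of_bound (poly_cont _).aestronglyMeasurable
    ((Fintype.card (Fin D → Fin n)) * ‖c‖) ?_
  exact (ae_restrict_mem (hcube_meas D)).mono fun y hy => Phi_bound D n c y hy

def PhiL (D n : ℕ) : ((Fin D → Fin n) → ℝ) →ₗ[ℝ] Lp ℝ 1 (volume.restrict (hcube D)) where
  toFun c := (Phi_memLp D n c).toLp _
  map_add' c d := by
    rw [← MemLp.toLp_add]
    apply MemLp.toLp_congr
    refine Filter.Eventually.of_forall fun z => ?_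
    simp
  map_smul' r c := by
    simp only [RingHom.id_apply]
    rw [← MemLp.toLp_const_smul]
    apply MemLp.toLp_congr
    refine Filter.Eventually.of_forall fun z => ?_
    simp

lemma PhiL_ker (D n : ℕ) : LinearMap.ker (PhiL D n) = ⊥ := by
  rw [LinearMap.ker_eq_bot']
  intro c hc
  have h1 : (fun z => MvPolynomial.eval z (Phi D n c)) =ᵐ[volume.restrict (hcube D)]
      (fun _ => (0:ℝ)) := by
    have := (Phi_memLp D n c).coeFn_toLp
    have h2 : (Phi_memLp D n c).toLp _ = 0 := hc
    rw [h2] at this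
    exact this.symm.trans (Lp.coeFn_zero _ _ _)
  have h2 := ae_restrict_of_ae_restrict_of_subset (unitCube_sub D) h1
  have hop : IsOpen (unitCube D) := by
    rw [unitCube_eq]
    exact isOpen_set_pi Set.finite_univ fun _ _ => isOpen_Ioo
  have h3 := Measure.eqOn_open_of_ae_eq h2 hop (poly_cont _).continuousOn continuousOn_const
  have h4 : Phi D n c = 0 := by
    refine MvPolynomial.funext_set (fun _ => Set.Ioo (0:ℝ) 1)
      (fun _ => Set.Ioo_infinite (by norm_num)) fun x hx => ?_
    rw [← unitCube_eq] at hx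
    simpa using h3 hx
  funext α
  rw [← Phi_coeff D n c α, h4]; simp

lemma poly_inv (D n : ℕ) (hn : 2 ≤ n) : ∃ C : ℝ≥0, ∀ p : MvPolynomial (Fin D) ℝ,
    (∀ i, p.degreeOf i ≤ n - 1) → ∀ y ∈ hcube D,
      ‖MvPolynomial.eval y p‖ₑ ≤ C * ∫⁻ z in hcube D, ‖MvPolynomial.eval z p‖ₑ := by
  obtain ⟨K, -, hK⟩ := (PhiL D n).exists_antilipschitzWith (PhiL_ker D n)
  refine ⟨(Fintype.card (Fin D → Fin n) : ℝ≥0) * K, fun p hp y hy => ?_⟩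
  obtain ⟨c, rfl⟩ := Phi_surj D n hn p hp
  have h1 := hK c 0
  rw [map_zero, edist_zero_right, edist_zero_right] at h1
  have h2 : ‖PhiL D n c‖ₑ = ∫⁻ z in hcube D, ‖MvPolynomial.eval z (Phi D n c)‖ₑ := by
    rw [← eLpNorm_one_eq_lintegral_enorm]
    exact Lp.enorm_toLp (Phi_memLp D n c)
  rw [← h2]
  have h3 : ‖MvPolynomial.eval y (Phi D n c)‖ₑ ≤ (Fintype.card (Fin D → Fin n) : ℝ≥0) * ‖c‖ₑ := by
    have := Phi_bound D n c y hy
    simp only [enorm_eq_nnnorm]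
    exact_mod_cast this
  refine h3.trans ?_
  rw [ENNReal.coe_mul, mul_assoc]
  gcongr

lemma poly_scale {D m : ℕ} (p : MvPolynomial (Fin D) ℝ) (hp : ∀ i, p.degreeOf i ≤ m)
    (b : Fin D → ℝ) (s : ℝ) : ∃ r : MvPolynomial (Fin D) ℝ, (∀ i, r.degreeOf i ≤ m) ∧
      ∀ y, MvPolynomial.eval y r = MvPolynomial.eval (s • (b + y)) p := by
  classical
  let g : Fin D → MvPolynomial (Fin D) ℝ := fun i =>
    MvPolynomial.C (s * b i) + MvPolynomial.C s * MvPolynomial.X i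
  have hg : ∀ i j, (g j).degreeOf i ≤ if i = j then 1 else 0 := by
    intro i j
    refine (MvPolynomial.degreeOf_add_le _ _ _).trans ?_
    rw [MvPolynomial.degreeOf_C]
    refine max_le (Nat.zero_le _) ((MvPolynomial.degreeOf_C_mul_le _ _ _).trans ?_)
    rw [MvPolynomial.degreeOf_X]
  refine ⟨∑ d ∈ p.support, MvPolynomial.C (p.coeff d) * ∏ j, g j ^ d j, fun i => ?_, fun y => ?_⟩
  · refine (MvPolynomial.degreeOf_sum_le _ _ _).trans (Finset.sup_le fun d hd => ?_)
    refine (MvPolynomial.degreeOf_C_mul_le _ _ _).trans ?_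
    refine (MvPolynomial.degreeOf_prod_le _ _ _).trans ?_
    calc _ ≤ ∑ j, d j * (if i = j then 1 else 0) := Finset.sum_le_sum fun j _ =>
          (MvPolynomial.degreeOf_pow_le _ _ _).trans (Nat.mul_le_mul_left _ (hg i j))
      _ = d i := by simp
      _ ≤ m := MvPolynomial.degreeOf_le_iff.1 (hp i) d hd
  · rw [MvPolynomial.eval_eq' (s • (b + y)) p, map_sum]
    refine Finset.sum_congr rfl fun d _ => ?_
    simp [g, mul_add]

lemma cell_eq (D M : ℕ) (k : Fin D → Fin M) :
    cell D M k = Set.pi Set.univ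
      (fun i => Set.Ico (((k i : ℕ) : ℝ) / M) ((((k i : ℕ) : ℝ) + 1) / M)) := by
  ext x; simp [cell]

lemma cell_meas (D M : ℕ) (k : Fin D → Fin M) : MeasurableSet (cell D M k) := by
  rw [cell_eq]
  exact MeasurableSet.univ_pi fun _ => measurableSet_Ico

lemma cell_vol (D M : ℕ) (k : Fin D → Fin M) :
    volume (cell D M k) = ENNReal.ofReal (((1:ℝ) / M) ^ D) := by
  rw [cell_eq, volume_pi_pi]
  simp only [Real.volume_Ico]
  have : ∀ i, (((k i : ℕ) : ℝ) + 1) / M - ((k i : ℕ) : ℝ) / M = 1 / M := by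
    intro i; ring
  simp only [this]
  rw [Finset.prod_const, ENNReal.ofReal_pow (by positivity)]
  simp

lemma cell_floor {D M : ℕ} (hM : 0 < M) {k : Fin D → Fin M} {x : Fin D → ℝ}
    (hx : x ∈ cell D M k) (i : Fin D) : ⌊x i * M⌋₊ = (k i : ℕ) := by
  have hM' : (0:ℝ) < M := by exact_mod_cast hM
  have h := hx i
  rw [div_le_iff₀ hM', lt_div_iff₀ hM'] at h
  rw [Nat.floor_eq_iff ((Nat.cast_nonneg _).trans h.1)]
  exact h

lemma cell_disj (D M : ℕ) (hM : 0 < M) : Pairwise (Function.onFun Disjoint (cell D M)) := by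
  intro k l hkl
  rw [Function.onFun, Set.disjoint_left]
  intro x hx hy
  apply hkl
  funext i
  apply Fin.ext
  rw [← cell_floor hM hx i, cell_floor hM hy i]

lemma cell_cover {D M : ℕ} (hM : 0 < M) {x : Fin D → ℝ} (hx : x ∈ hcube D) :
    ∃ k, x ∈ cell D M k := by
  have hM' : (0:ℝ) < M := by exact_mod_cast hM
  have hx' : ∀ i, 0 ≤ x i * M ∧ x i * M < M := fun i => by
    have := hx i (Set.mem_univ i)
    constructor
    · exact mul_nonneg this.1 hM'.le
    · nlinarith [this.2]
  refine ⟨fun i => ⟨⌊x i * M⌋₊, (Nat.floor_lt (hx' i).1).2 (hx' i).2⟩, fun i => ?_⟩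
  rw [div_le_iff₀ hM', lt_div_iff₀ hM']
  exact ⟨Nat.floor_le (hx' i).1, Nat.lt_floor_add_one _⟩

lemma cell_sub_hcube {D M : ℕ} (hM : 0 < M) (k : Fin D → Fin M) : cell D M k ⊆ hcube D := by
  have hM' : (0:ℝ) < M := by exact_mod_cast hM
  intro x hx i _
  have h := hx i
  refine ⟨le_trans (by positivity) h.1, h.2.trans_le ?_⟩
  rw [div_le_one hM']
  exact_mod_cast (k i).2

lemma cell_scale {D M : ℕ} (hM : 0 < M) (k : Fin D → Fin M) (f : (Fin D → ℝ) → ℝ≥0∞)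
    (hf : Measurable f) :
    ∫⁻ z in hcube D, f ((M:ℝ)⁻¹ • ((fun i => ((k i : ℕ):ℝ)) + z)) =
      ENNReal.ofReal ((M:ℝ) ^ D) * ∫⁻ x in cell D M k, f x := by
  have hM' : (0:ℝ) < M := by exact_mod_cast hM
  set b : Fin D → ℝ := fun i => ((k i : ℕ):ℝ)
  have hmeas : Measurable (fun z : Fin D → ℝ => (M:ℝ)⁻¹ • (b + z)) := by fun_prop
  have hmap : Measure.map (fun z : Fin D → ℝ => (M:ℝ)⁻¹ • (b + z)) volume =
      ENNReal.ofReal ((M:ℝ) ^ D) • volume := by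
    have : (fun z : Fin D → ℝ => (M:ℝ)⁻¹ • (b + z)) =
        (fun z => (M:ℝ)⁻¹ • z) ∘ (fun z => b + z) := rfl
    rw [this, ← Measure.map_map (by fun_prop) (by fun_prop), map_add_left_eq_self]
    have := Measure.map_addHaar_smul (volume : Measure (Fin D → ℝ)) (r := (M:ℝ)⁻¹) (by positivity)
    refine this.trans ?_
    congr 2
    simp
  have hpre : (fun z : Fin D → ℝ => (M:ℝ)⁻¹ • (b + z)) ⁻¹' cell D M k = hcube D := by
    ext z
    simp only [Set.mem_preimage, cell, hcube, Set.mem_ofPred_eq, Set.mem_pi, Set.mem_univ,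
      true_implies, Set.mem_Ico]
    refine forall_congr' fun i => ?_
    rw [div_le_iff₀ hM', lt_div_iff₀ hM']
    have : ((M:ℝ)⁻¹ • (b + z)) i * M = (k i : ℕ) + z i := by
      simp [b]; field_simp
    rw [this]
    constructor <;> rintro ⟨h1, h2⟩ <;> constructor <;> linarith
  rw [← hpre, ← lintegral_map (μ := volume.restrict _) hf hmeas,
    ← Measure.restrict_map hmeas (cell_meas D M k), hmap, Measure.restrict_smul,
    lintegral_smul_measure, smul_eq_mul]

lemma jensen (D : ℕ) (q : ℝ) (hq : 1 ≤ q) (f : (Fin D → ℝ) → ℝ) (hf : Continuous f) :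
    (∫⁻ z in hcube D, ‖f z‖ₑ) ^ q ≤ ∫⁻ z in hcube D, ‖f z‖ₑ ^ q := by
  have hq0 : 0 < q := by linarith
  have h := eLpNorm_le_eLpNorm_of_exponent_le (μ := volume.restrict (hcube D)) (f := f)
    (p := 1) (q := ENNReal.ofReal q) (by simpa using hq) hf.aestronglyMeasurable
  rw [eLpNorm_one_eq_lintegral_enorm, eLpNorm_eq_lintegral_rpow_enorm_toReal (by simpa using hq0)
    (by simp), ENNReal.toReal_ofReal hq0.le] at h
  have := ENNReal.rpow_le_rpow h hq0.le
  rwa [← ENNReal.rpow_mul, one_div_mul_cancel hq0.ne', ENNReal.rpow_one] at this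

lemma cell_inv (D n : ℕ) (hn : 2 ≤ n) (q : ℝ) (hq : 1 ≤ q) : ∃ C : ℝ≥0, ∀ M : ℕ, 0 < M →
    ∀ v, IsSpline D M n v → ∀ k : Fin D → Fin M, ∀ x ∈ cell D M k,
      ‖v x‖ₑ ^ q ≤ C * ENNReal.ofReal ((M:ℝ) ^ D) * ∫⁻ z in cell D M k, ‖v z‖ₑ ^ q := by
  have hq0 : 0 < q := by linarith
  obtain ⟨C, hC⟩ := poly_inv D n hn
  refine ⟨C ^ q, fun M hM v hv k x hx => ?_⟩
  have hM' : (0:ℝ) < M := by exact_mod_cast hM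
  obtain ⟨p, hp, hvp⟩ := hv.2 k
  obtain ⟨r, hr, hrp⟩ := poly_scale p hp (fun i => ((k i : ℕ):ℝ)) (M:ℝ)⁻¹
  have h1 : ∫⁻ z in cell D M k, ‖v z‖ₑ ^ q = ∫⁻ z in cell D M k, ‖MvPolynomial.eval z p‖ₑ ^ q := by
    refine setLIntegral_congr_fun (cell_meas D M k) fun z hz => ?_
    simp only [hvp z hz]
  have h2 := cell_scale hM k (fun z => ‖MvPolynomial.eval z p‖ₑ ^ q)
    ((poly_cont p).measurable.enorm.pow_const q)
  rw [h1, mul_assoc, ← h2]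
  simp only [← hrp]
  set y : Fin D → ℝ := fun i => x i * M - (k i : ℕ) with hy
  have hyc : y ∈ hcube D := by
    intro i _
    have h := hx i
    rw [div_le_iff₀ hM', lt_div_iff₀ hM'] at h
    simp only [hy, Set.mem_Ico]
    constructor <;> linarith [h.1, h.2]
  have hxy : x = (M:ℝ)⁻¹ • ((fun i => ((k i : ℕ):ℝ)) + y) := by
    funext i
    simp [hy]
    field_simp
  rw [hvp x hx]
  have h3 : MvPolynomial.eval x p = MvPolynomial.eval y r := by rw [hrp, ← hxy]
  rw [h3]
  refine (ENNReal.rpow_le_rpow (hC r hr y hyc) hq0.le).trans ?_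
  rw [ENNReal.mul_rpow_of_nonneg _ _ hq0.le, ENNReal.coe_rpow_of_nonneg _ hq0.le]
  gcongr
  exact jensen D q hq _ (poly_cont r)

lemma Icc_ae_unitCube (D : ℕ) : unitCube D =ᵐ[volume] Set.Icc (0 : Fin D → ℝ) 1 := by
  rw [unitCube_eq]
  exact Measure.univ_pi_Ioo_ae_eq_Icc (f := fun _ => (0:ℝ)) (g := fun _ => (1:ℝ))

lemma hcube_ae_Icc (D : ℕ) : hcube D =ᵐ[volume] Set.Icc (0 : Fin D → ℝ) 1 :=
  Measure.univ_pi_Ico_ae_eq_Icc (f := fun _ => (0:ℝ)) (g := fun _ => (1:ℝ))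

lemma hcube_sub_Icc (D : ℕ) : hcube D ⊆ Set.Icc (0 : Fin D → ℝ) 1 := by
  intro x hx
  exact ⟨fun i => (hx i (Set.mem_univ i)).1, fun i => (hx i (Set.mem_univ i)).2.le⟩

lemma image_sub {D : ℕ} {T : ℝ} (F : FlowData D T) {K : ℕ} (hK : 0 < K) {t : ℝ}
    (ht : t ∈ Set.Icc (0:ℝ) T) (k : Fin D → Fin K) :
    F.X 0 t '' cell D K k ⊆ Set.Icc (0 : Fin D → ℝ) 1 := by
  rintro _ ⟨x, hx, rfl⟩
  exact flow_invariant F x (hcube_sub_Icc D (cell_sub_hcube hK k hx)) t ht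

lemma cell_dist {D M : ℕ} {k : Fin D → Fin M} {x y : Fin D → ℝ}
    (hx : x ∈ cell D M k) (hy : y ∈ cell D M k) : dist x y ≤ 1 / M := by
  rw [dist_pi_le_iff (by positivity)]
  intro i
  have h1 := hx i
  have h2 := hy i
  have : (((k i : ℕ) : ℝ) + 1) / M = ((k i : ℕ) : ℝ) / M + 1 / M := by ring
  rw [Real.dist_eq, abs_le]
  constructor <;> linarith [h1.1, h1.2, h2.1, h2.2]

open Classical in
lemma count_bound {D : ℕ} {T : ℝ} (F : FlowData D T) {G : ℝ} (hG0 : 0 < G)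
    (hG : ∀ x ∈ Set.Icc (0 : Fin D → ℝ) 1, ∀ y ∈ Set.Icc (0 : Fin D → ℝ) 1,
      ∀ t ∈ Set.Icc (0:ℝ) T, dist x y ≤ G * dist (F.X 0 t x) (F.X 0 t y))
    {M K : ℕ} (hM : 0 < M) (hMK : M ≤ K) {t : ℝ} (ht : t ∈ Set.Icc (0:ℝ) T)
    (j : Fin D → Fin M) :
    ∑ k ∈ Finset.univ.filter (fun k : Fin D → Fin K => (F.X 0 t '' cell D K k ∩ cell D M j).Nonempty),
      ENNReal.ofReal (((1:ℝ) / K) ^ D) ≤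
      ENNReal.ofReal ((2 * (G + 1)) ^ D) * ENNReal.ofReal (((1:ℝ) / M) ^ D) := by
  have hK : 0 < K := hM.trans_le hMK
  have hM' : (0:ℝ) < M := by exact_mod_cast hM
  have hMK' : (M:ℝ) ≤ K := by exact_mod_cast hMK
  set J := Finset.univ.filter
    (fun k : Fin D → Fin K => (F.X 0 t '' cell D K k ∩ cell D M j).Nonempty) with hJ
  rcases J.eq_empty_or_nonempty with h0 | ⟨k0, hk0⟩
  · rw [h0]; simp
  have hJm : ∀ k ∈ J, ∃ x ∈ cell D K k, F.X 0 t x ∈ cell D M j := by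
    intro k hk
    obtain ⟨_, ⟨x, hx, rfl⟩, h⟩ := (Finset.mem_filter.1 hk).2
    exact ⟨x, hx, h⟩
  obtain ⟨x0, hx0, hx0j⟩ := hJm k0 hk0
  have hsub : (⋃ k ∈ J, cell D K k) ⊆ Metric.closedBall x0 ((G + 1) * (1 / M)) := by
    intro z hz
    obtain ⟨k, hk, hzk⟩ := Set.mem_iUnion₂.1 hz
    obtain ⟨x, hx, hxj⟩ := hJm k hk
    have h1 := hG x (hcube_sub_Icc D (cell_sub_hcube hK k hx)) x0
      (hcube_sub_Icc D (cell_sub_hcube hK k0 hx0)) t ht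
    have h2 := cell_dist hxj hx0j
    have h3 := cell_dist hzk hx
    have h4 : (1:ℝ) / K ≤ 1 / M := one_div_le_one_div_of_le hM' hMK'
    rw [Metric.mem_closedBall]
    calc dist z x0 ≤ dist z x + dist x x0 := dist_triangle _ _ _
      _ ≤ 1 / M + G * (1 / M) := add_le_add (h3.trans h4) (h1.trans (by gcongr))
      _ = _ := by ring
  calc ∑ k ∈ J, ENNReal.ofReal (((1:ℝ) / K) ^ D) = ∑ k ∈ J, volume (cell D K k) := by
        simp only [cell_vol]
    _ = volume (⋃ k ∈ J, cell D K k) := by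
        rw [measure_biUnion_finset]
        · intro k _ l _ hkl
          exact cell_disj D K hK hkl
        · exact fun k _ => cell_meas D K k
    _ ≤ volume (Metric.closedBall x0 ((G + 1) * (1 / M))) := measure_mono hsub
    _ = _ := by
        rw [Real.volume_pi_closedBall _ (by positivity), ← ENNReal.ofReal_mul (by positivity)]
        congr 1
        rw [Fintype.card_fin, ← mul_pow]
        ring

open Classical in
lemma local_sup {D : ℕ} {S : Set (Fin D → ℝ)} (hS : S ⊆ Set.Icc (0 : Fin D → ℝ) 1)
    {M : ℕ} (hM : 0 < M) (q : ℝ) (hq : 1 ≤ q) (v : (Fin D → ℝ) → ℝ)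
    (B : (Fin D → Fin M) → ℝ≥0∞) (hB : ∀ j, ∀ x ∈ cell D M j, ‖v x‖ₑ ^ q ≤ B j) :
    eLpNorm v ⊤ (volume.restrict S) ^ q ≤
      ∑ j ∈ Finset.univ.filter (fun j : Fin D → Fin M => (S ∩ cell D M j).Nonempty), B j := by
  have hq0 : 0 < q := by linarith
  set J := Finset.univ.filter (fun j : Fin D → Fin M => (S ∩ cell D M j).Nonempty) with hJ
  rw [← ENNReal.le_rpow_inv_iff hq0, eLpNorm_exponent_top]
  refine eLpNormEssSup_le_of_ae_enorm_bound ?_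
  set N := Set.Icc (0 : Fin D → ℝ) 1 \ hcube D with hN
  have hN0 : volume N = 0 := ae_le_set.1 (hcube_ae_Icc D).symm.le
  have hsub : S ⊆ N ∪ ⋃ j ∈ J, cell D M j := by
    intro x hx
    by_cases h : x ∈ hcube D
    · right
      obtain ⟨j, hj⟩ := cell_cover hM h
      exact Set.mem_iUnion₂.2 ⟨j, Finset.mem_filter.2 ⟨Finset.mem_univ _, ⟨x, hx, hj⟩⟩, hj⟩
    · exact Or.inl ⟨hS hx, h⟩
  refine ae_restrict_of_ae_restrict_of_subset hsub ?_
  have hNm : MeasurableSet N := measurableSet_Icc.diff (hcube_meas D)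
  have hm : MeasurableSet (N ∪ ⋃ j ∈ J, cell D M j) :=
    hNm.union (Finset.measurableSet_biUnion _ fun j _ => cell_meas D M j)
  rw [ae_restrict_iff' hm]
  have hae : ∀ᵐ x ∂(volume : Measure (Fin D → ℝ)), x ∉ N := measure_eq_zero_iff_ae_notMem.1 hN0
  filter_upwards [hae] with x hx hxm
  rcases hxm with h | h
  · exact absurd h hx
  obtain ⟨j, hj, hxj⟩ := Set.mem_iUnion₂.1 h
  rw [ENNReal.le_rpow_inv_iff hq0]
  exact (hB j x hxj).trans (Finset.single_le_sum (f := B) (fun _ _ => zero_le) hj)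

lemma sum_cells {D M : ℕ} (hM : 0 < M) (f : (Fin D → ℝ) → ℝ≥0∞) :
    ∑ j : Fin D → Fin M, ∫⁻ x in cell D M j, f x ≤ ∫⁻ x in unitCube D, f x := by
  have h1 : unitCube D =ᵐ[volume] hcube D := (Icc_ae_unitCube D).trans (hcube_ae_Icc D).symm
  rw [setLIntegral_congr h1]
  have h2 := lintegral_biUnion_finset (μ := volume) (s := Finset.univ) (t := cell D M)
    (fun k _ l _ hkl => cell_disj D M hM hkl) (fun k _ => cell_meas D M k) f
  rw [← h2]
  exact lintegral_mono_set (Set.iUnion₂_subset fun k _ => cell_sub_hcube hM k)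

/-- `ℓ^q` version of the weighted sum of local sup-norms.
Let `n ≥ 2`, `h = 1/K ≤ σ = 1/M` and `q ∈ [1,∞]`.  There is a constant `C > 0` depending
only on the velocity field (through `F`), `n`, `q`, `D` and `T` such that for every
`t ∈ [0,T]` and every spline `v_σ ∈ V_σ^n(Ω)`:
`(Σ_i w_i ‖v_σ‖_{L^∞(X_{0→t}(Q_i^h))}^q)^{1/q} ≤ C ‖v_σ‖_{L^q(Ω)}`,
with the usual modification `max_i ‖v_σ‖_{L^∞(X_{0→t}(Q_i^h))} ≤ C ‖v_σ‖_{L^∞(Ω)}` for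
`q = ∞`. -/
theorem sum_local_sup_le_Lq
    (D : ℕ) (hD : 0 < D) (T : ℝ) (hT : 0 < T) (F : FlowData D T)
    (n : ℕ) (hn : 2 ≤ n) (q : ℝ≥0∞) (hq : 1 ≤ q) :
    ∃ C : ℝ, 0 < C ∧
      ∀ M K : ℕ, 0 < M → M ≤ K →
      ∀ t ∈ Set.Icc (0 : ℝ) T,
      ∀ v : (Fin D → ℝ) → ℝ, IsSpline D M n v →
        (q ≠ ⊤ →
          (∑ k : Fin D → Fin K,
              ENNReal.ofReal (((1 : ℝ) / K) ^ D) *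
                eLpNorm v ⊤ (volume.restrict (F.X 0 t '' cell D K k)) ^ q.toReal) ^
              (1 / q.toReal) ≤
            ENNReal.ofReal C * eLpNorm v q (volume.restrict (unitCube D))) ∧
        (q = ⊤ →
          ∀ k : Fin D → Fin K,
            eLpNorm v ⊤ (volume.restrict (F.X 0 t '' cell D K k)) ≤
              ENNReal.ofReal C * eLpNorm v ⊤ (volume.restrict (unitCube D))) := by
  classical
  by_cases hqt : q = ⊤
  · refine ⟨1, one_pos, fun M K hM hMK t ht v hv => ⟨fun h => absurd hqt h, fun _ k => ?_⟩⟩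
    rw [ENNReal.ofReal_one, one_mul, Measure.restrict_congr_set (Icc_ae_unitCube D)]
    exact eLpNorm_mono_measure _
      (Measure.restrict_mono (image_sub F (hM.trans_le hMK) ht k) le_rfl)
  have hq1 : 1 ≤ q.toReal := by
    rw [← ENNReal.toReal_one]
    exact ENNReal.toReal_mono hqt hq
  have hq0 : 0 < q.toReal := by linarith
  obtain ⟨C, hC⟩ := cell_inv D n hn q.toReal hq1
  obtain ⟨G, hG0, hG⟩ := flow_back_lip F
  set A : ℝ := ((C : ℝ) + 1) * (2 * (G + 1)) ^ D with hA
  have hA0 : 0 < A := by positivity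
  refine ⟨A ^ (1 / q.toReal), by positivity,
    fun M K hM hMK t ht v hv => ⟨fun _ => ?_, fun h => absurd h hqt⟩⟩
  have hM' : (0:ℝ) < M := by exact_mod_cast hM
  rw [eLpNorm_eq_lintegral_rpow_enorm_toReal (by rintro rfl; simp at hq) hqt,
    ← ENNReal.ofReal_rpow_of_pos hA0, ← ENNReal.mul_rpow_of_nonneg _ _ (by positivity)]
  refine ENNReal.rpow_le_rpow ?_ (by positivity)
  set B : (Fin D → Fin M) → ℝ≥0∞ := fun j =>
    C * ENNReal.ofReal ((M:ℝ) ^ D) * ∫⁻ z in cell D M j, ‖v z‖ₑ ^ q.toReal with hBdef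
  calc _ ≤ ∑ k : Fin D → Fin K, ENNReal.ofReal (((1 : ℝ) / K) ^ D) *
        ∑ j ∈ Finset.univ.filter
          (fun j : Fin D → Fin M => (F.X 0 t '' cell D K k ∩ cell D M j).Nonempty), B j := by
        refine Finset.sum_le_sum fun k _ => ?_
        gcongr
        exact local_sup (image_sub F (hM.trans_le hMK) ht k) hM q.toReal hq1 v B
          (fun j x hx => hC M hM v hv j x hx)
    _ = ∑ j : Fin D → Fin M, (∑ k ∈ Finset.univ.filter
          (fun k : Fin D → Fin K => (F.X 0 t '' cell D K k ∩ cell D M j).Nonempty),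
            ENNReal.ofReal (((1 : ℝ) / K) ^ D)) * B j := by
        simp only [Finset.sum_filter, Finset.mul_sum, Finset.sum_mul]
        rw [Finset.sum_comm]
        refine Finset.sum_congr rfl fun j _ => Finset.sum_congr rfl fun k _ => ?_
        split_ifs <;> simp
    _ ≤ ∑ j : Fin D → Fin M, ENNReal.ofReal A * ∫⁻ z in cell D M j, ‖v z‖ₑ ^ q.toReal := by
        refine Finset.sum_le_sum fun j _ => ?_
        refine (mul_le_mul_left (count_bound F hG0 hG hM hMK ht j) _).trans ?_
        simp only [hBdef]
        rw [← mul_assoc]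
        gcongr
        rw [← ENNReal.ofReal_coe_nnreal, ← ENNReal.ofReal_mul (by positivity),
          ← ENNReal.ofReal_mul (by positivity), ← ENNReal.ofReal_mul (by positivity)]
        apply ENNReal.ofReal_le_ofReal
        have : ((1:ℝ) / M) ^ D * (M:ℝ) ^ D = 1 := by
          rw [← mul_pow, one_div_mul_cancel hM'.ne', one_pow]
        have e : (2 * (G + 1)) ^ D * (1 / (M:ℝ)) ^ D * (C * (M:ℝ) ^ D) =
            C * (2 * (G + 1)) ^ D * ((1 / (M:ℝ)) ^ D * (M:ℝ) ^ D) := by ring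
        rw [e, this, mul_one, hA]
        gcongr
        linarith
    _ ≤ _ := by
        rw [← Finset.mul_sum]
        gcongr
        exact sum_cells hM _

end
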